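/- Let T be an operator on ℓ²(ℤ², ℂ) with kernel T(x,y) satisfying |T(x,y)| ≤ C |x-y| e^{-ν|x-y|} ⟨y⟩^{-1} for some C, ν > 0. Then T belongs to the Schatten class L³ (i.e., |T|³ is trace class). -/

import Mathlib

local notation "⟪" x ", " y "⟫" => @inner ℂ _ _ x y

/-- `ℓ²(ℤ²,ℂ)`. -/
noncomputable abbrev Ltwo : Type := lp (fun _ : ℤ × ℤ => ℂ) 2

/-- Euclidean norm of a point of `ℤ²`. -/
noncomputable def zn (p : ℤ × ℤ) : ℝ := Real.sqrt ((p.1 : ℝ) ^ 2 + (p.2 : ℝ) ^ 2)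

/-- The standard basis vector `δ_x` of `ℓ²(ℤ²,ℂ)`. -/
noncomputable def del (x : ℤ × ℤ) : Ltwo := lp.single 2 x 1

/-- The Japanese bracket `⟨p⟩ = (1 + |p|²)^{1/2}` on `ℤ²`. -/
noncomputable def japaneseBracket (p : ℤ × ℤ) : ℝ := Real.sqrt (1 + zn p ^ 2)

lemma zn_nonneg (p : ℤ × ℤ) : 0 ≤ zn p := Real.sqrt_nonneg _

lemma zn_eq_norm (p : ℤ × ℤ) : zn p = ‖(⟨p.1, p.2⟩ : ℂ)‖ := by
  rw [zn, Complex.norm_eq_sqrt_sq_add_sq]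

lemma zn_sub_comm (p q : ℤ × ℤ) : zn (p - q) = zn (q - p) := by
  simp only [zn, Prod.fst_sub, Prod.snd_sub, Int.cast_sub]
  congr 1
  ring

lemma zn_le_add (p q : ℤ × ℤ) : zn p ≤ zn q + zn (p - q) := by
  simp only [zn_eq_norm]
  refine le_trans (le_of_eq ?_) (norm_add_le _ _)
  congr 1
  apply Complex.ext <;> simp

lemma norm_le_zn (p : ℤ × ℤ) : ‖p‖ ≤ zn p := by
  rw [Prod.norm_def, Int.norm_eq_abs, Int.norm_eq_abs]
  exact max_le (Real.abs_le_sqrt (by nlinarith [sq_nonneg (p.2 : ℝ)]))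
    (Real.abs_le_sqrt (by nlinarith [sq_nonneg (p.1 : ℝ)]))

lemma one_le_japaneseBracket (p : ℤ × ℤ) : 1 ≤ japaneseBracket p :=
  Real.one_le_sqrt.mpr (by nlinarith [sq_nonneg (zn p)])

lemma japaneseBracket_pos (p : ℤ × ℤ) : 0 < japaneseBracket p :=
  one_pos.trans_le (one_le_japaneseBracket p)

lemma zn_le_japaneseBracket (p : ℤ × ℤ) : zn p ≤ japaneseBracket p :=
  Real.le_sqrt_of_sq_le (by linarith)

lemma japaneseBracket_le_one_add_zn (p : ℤ × ℤ) : japaneseBracket p ≤ 1 + zn p :=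
  Real.sqrt_le_iff.mpr ⟨by linarith [zn_nonneg p], by nlinarith [zn_nonneg p]⟩

lemma japaneseBracket_le_add (p q : ℤ × ℤ) :
    japaneseBracket p ≤ japaneseBracket q + zn (p - q) := by
  have h := zn_le_add p q
  have hq : japaneseBracket q ^ 2 = 1 + zn q ^ 2 := Real.sq_sqrt (by positivity)
  have hz := zn_le_japaneseBracket q
  refine Real.sqrt_le_iff.mpr ⟨by linarith [japaneseBracket_pos q, zn_nonneg (p - q)], ?_⟩
  nlinarith [zn_nonneg p, zn_nonneg q, zn_nonneg (p - q)]

lemma inv_japaneseBracket_le (p q : ℤ × ℤ) :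
    (japaneseBracket q)⁻¹ ≤ (1 + zn (p - q)) * (japaneseBracket p)⁻¹ := by
  rw [← div_eq_mul_inv, inv_eq_one_div,
    div_le_div_iff₀ (japaneseBracket_pos q) (japaneseBracket_pos p)]
  nlinarith [japaneseBracket_le_add p q, one_le_japaneseBracket q, zn_nonneg (p - q)]

lemma summable_inv_japaneseBracket_pow_three :
    Summable fun p : ℤ × ℤ => (japaneseBracket p)⁻¹ ^ 3 := by
  have h := (finTwoArrowEquiv ℤ).symm.summable_iff.mpr
    (EisensteinSeries.summable_one_div_norm_rpow (k := 3) (by norm_num))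
  refine h.of_norm_bounded_eventually ?_
  refine (Set.finite_singleton (0 : ℤ × ℤ)).subset fun p hp => ?_
  by_contra hne
  refine hp ?_
  have hn : ‖(finTwoArrowEquiv ℤ).symm p‖ = ‖p‖ := by
    simp [Pi.norm_def, Prod.norm_def, Fin.univ_succ]
  have hpos : 0 < ‖p‖ := norm_pos_iff.mpr hne
  have hle := (norm_le_zn p).trans (zn_le_japaneseBracket p)
  have hJ := japaneseBracket_pos p
  change ‖(japaneseBracket p)⁻¹ ^ 3‖ ≤ ‖(finTwoArrowEquiv ℤ).symm p‖ ^ (-3 : ℝ)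
  rw [hn, Real.norm_of_nonneg (by positivity), Real.rpow_neg hpos.le, inv_pow,
    show (3 : ℝ) = ((3 : ℕ) : ℝ) by norm_num, Real.rpow_natCast]
  gcongr

lemma summable_exp_decay (C ν : ℝ) (hC : 0 ≤ C) (hν : 0 < ν) :
    Summable fun p : ℤ × ℤ => C * zn p * Real.exp (-ν * zn p) * (1 + zn p) := by
  refine Summable.of_nonneg_of_le (fun p => ?_) (fun p => ?_)
    (summable_inv_japaneseBracket_pow_three.mul_left (C * (120 / ν ^ 5 * Real.exp ν)))
  · have := zn_nonneg p
    positivity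
  · have ht := zn_nonneg p
    have hJ := japaneseBracket_pos p
    have hexp : (1 + zn p) ^ 5 ≤ 120 / ν ^ 5 * Real.exp ν * Real.exp (ν * zn p) := by
      have h := Real.pow_div_factorial_le_exp (ν * (1 + zn p)) (by positivity) 5
      rw [mul_add, mul_one, Real.exp_add, ← mul_one_add, mul_pow,
        show ((Nat.factorial 5 : ℕ) : ℝ) = 120 by norm_num [Nat.factorial],
        div_le_iff₀ (by norm_num)] at h
      rw [mul_assoc, div_mul_eq_mul_div, le_div_iff₀ (by positivity)]
      linarith
    have hmain : (1 + zn p) ^ 2 * Real.exp (-ν * zn p) * (1 + zn p) ^ 3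
        ≤ 120 / ν ^ 5 * Real.exp ν := by
      calc (1 + zn p) ^ 2 * Real.exp (-ν * zn p) * (1 + zn p) ^ 3
          = (1 + zn p) ^ 5 * Real.exp (-ν * zn p) := by ring
        _ ≤ 120 / ν ^ 5 * Real.exp ν * Real.exp (ν * zn p) * Real.exp (-ν * zn p) := by gcongr
        _ = 120 / ν ^ 5 * Real.exp ν := by
          rw [mul_assoc, ← Real.exp_add]
          simp
    rw [mul_assoc C, mul_assoc C, mul_assoc C]
    refine mul_le_mul_of_nonneg_left ?_ hC
    rw [inv_pow, ← div_eq_mul_inv, le_div_iff₀ (by positivity)]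
    refine le_trans ?_ hmain
    have hle := japaneseBracket_le_one_add_zn p
    have hz : zn p * Real.exp (-ν * zn p) * (1 + zn p)
        ≤ (1 + zn p) ^ 2 * Real.exp (-ν * zn p) := by
      nlinarith [mul_nonneg (Real.exp_nonneg (-ν * zn p)) (by positivity : 0 ≤ 1 + zn p)]
    gcongr

lemma inner_del (x : ℤ × ℤ) (f : Ltwo) : ⟪del x, f⟫ = f x := by
  rw [del, lp.inner_single_left]
  simp

lemma hasSum_smul_del (f : Ltwo) : HasSum (fun x => f x • del x) f := by
  convert lp.hasSum_single (p := 2) (by norm_num) f using 2 with x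
  rw [del, ← lp.single_smul]
  simp

/-- A bounded operator applied to `f` is controlled by the coordinates of `f` and the
norms of its columns. -/
lemma norm_apply_le_tsum (A : Ltwo →L[ℂ] Ltwo) (f : Ltwo) {g : ℤ × ℤ → ℝ} (hg : Summable g)
    (h : ∀ x, ‖f x‖ * ‖A (del x)‖ ≤ g x) : ‖A f‖ ≤ ∑' x, g x := by
  have hA := A.hasSum (hasSum_smul_del f)
  rw [← hA.tsum_eq]
  refine tsum_of_norm_bounded hg.hasSum fun x => ?_
  simpa [norm_smul] using h x

lemma norm_del (x : ℤ × ℤ) : ‖del x‖ = 1 := by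
  simp [del]

lemma exists_isPositive_mul_self_eq {H : Type*} [NormedAddCommGroup H] [InnerProductSpace ℂ H]
    [CompleteSpace H] (T : H →L[ℂ] H) :
    ∃ S : H →L[ℂ] H, S.IsPositive ∧ S * S = star T * T :=
  ⟨CFC.abs T, (ContinuousLinearMap.nonneg_iff_isPositive _).mp (CFC.abs_nonneg T),
    CFC.abs_mul_abs T⟩

lemma norm_apply_eq_of_mul_self_eq {S T : Ltwo →L[ℂ] Ltwo} (hS : S.IsPositive)
    (hST : S * S = star T * T) (f : Ltwo) : ‖S f‖ = ‖T f‖ := by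
  have h1 := S.apply_norm_sq_eq_inner_adjoint_left f
  have h2 := T.apply_norm_sq_eq_inner_adjoint_left f
  rw [hS.isSelfAdjoint.adjoint_eq] at h1
  rw [← ContinuousLinearMap.star_eq_adjoint] at h2
  change _ = RCLike.re (inner ℂ ((S * S) f) f) at h1
  change _ = RCLike.re (inner ℂ ((star T * T) f) f) at h2
  rw [hST, ← h2] at h1
  exact (sq_eq_sq₀ (norm_nonneg _) (norm_nonneg _)).mp h1

lemma abs_re_inner_pow_three_le {S T : Ltwo →L[ℂ] Ltwo} (hS : S.IsPositive)
    (hST : S * S = star T * T) (f : Ltwo) :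
    |(⟪f, (S ^ 3) f⟫).re| ≤ ‖T f‖ * ‖star T (T f)‖ := by
  have h3 : (S ^ 3) f = S ((S * S) f) := by
    rw [pow_succ', pow_two]
    rfl
  have hsym : ⟪f, (S ^ 3) f⟫ = ⟪S f, star T (T f)⟫ := by
    rw [h3, hST, ← ContinuousLinearMap.adjoint_inner_left, hS.isSelfAdjoint.adjoint_eq]
    rfl
  rw [hsym, ← norm_apply_eq_of_mul_self_eq hS hST f]
  exact (Complex.abs_re_le_norm _).trans (norm_inner_le_norm _ _)

/-- If the kernel `T(x,y) = ⟨δ_x, T δ_y⟩` of an operator `T` on `ℓ²(ℤ²,ℂ)`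
satisfies `|T(x,y)| ≤ C |x-y| e^{-ν|x-y|} ⟨y⟩^{-1}`, then `T` is in the Schatten class
`L³`, i.e. `|T|³` is trace class (here `S = |T|` is the positive square root of `T*T`,
and trace-class of the positive operator `S³` is stated as summability of its diagonal
in the standard orthonormal basis). -/
theorem stmt3 (T : Ltwo →L[ℂ] Ltwo) (C ν : ℝ) (hC : 0 < C) (hν : 0 < ν)
    (hker : ∀ x y : ℤ × ℤ,
      ‖⟪del x, T (del y)⟫‖ ≤ C * zn (x - y) * Real.exp (-ν * zn (x - y))
        / Real.sqrt (1 + zn y ^ 2)) :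
    ∃ S : Ltwo →L[ℂ] Ltwo, S.IsPositive ∧ S * S = star T * T ∧
      Summable fun x : ℤ × ℤ => (⟪del x, (S ^ 3) (del x)⟫).re := by
  obtain ⟨S, hS, hST⟩ := exists_isPositive_mul_self_eq T
  refine ⟨S, hS, hST, ?_⟩
  set G : ℤ × ℤ → ℝ := fun p => C * zn p * Real.exp (-ν * zn p) * (1 + zn p) with hG
  have hGsum : Summable G := summable_exp_decay C ν hC.le hν
  have hGnonneg : ∀ p, 0 ≤ G p := fun p => by
    have := zn_nonneg p
    positivity
  set K : ℝ := ∑' p, G p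
  have hK : 0 ≤ K := tsum_nonneg hGnonneg
  have hGcomm : ∀ x y, G (x - y) = G (y - x) := fun x y => by
    simp only [hG, zn_sub_comm x y]
  have hshift : ∀ x, HasSum (fun y => G (y - x)) K := fun x =>
    (Equiv.subRight x).hasSum_iff.mpr hGsum.hasSum
  have hcoord : ∀ x y, ‖(T (del y)) x‖ ≤
      C * zn (x - y) * Real.exp (-ν * zn (x - y)) * (japaneseBracket y)⁻¹ := fun x y => by
    rw [← inner_del, ← div_eq_mul_inv]
    exact hker x y
  have hcol : ∀ x y, ‖(T (del y)) x‖ ≤ G (x - y) * (japaneseBracket y)⁻¹ := fun x y => by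
    have := zn_nonneg (x - y)
    have := japaneseBracket_pos y
    refine (hcoord x y).trans (mul_le_mul_of_nonneg_right ?_ (by positivity))
    exact le_mul_of_one_le_right (by positivity) (by linarith)
  have hrow : ∀ x y, ‖(T (del y)) x‖ ≤ G (y - x) * (japaneseBracket x)⁻¹ := fun x y => by
    have := zn_nonneg (x - y)
    refine (hcoord x y).trans ?_
    rw [hGcomm, hG, mul_assoc _ (1 + zn (x - y))]
    exact mul_le_mul_of_nonneg_left (inv_japaneseBracket_le x y) (by positivity)
  have hT : ∀ x, ‖T (del x)‖ ≤ K * (japaneseBracket x)⁻¹ := fun x => by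
    have hs := (hshift x).mul_right (japaneseBracket x)⁻¹
    rw [← hs.tsum_eq]
    refine norm_apply_le_tsum 1 (T (del x)) hs.summable fun w => ?_
    simpa [norm_del] using hcol w x
  have hTstar : ∀ w, ‖star T (del w)‖ ≤ K * (japaneseBracket w)⁻¹ := fun w => by
    have hs := (hshift w).mul_right (japaneseBracket w)⁻¹
    rw [← hs.tsum_eq]
    refine norm_apply_le_tsum 1 (star T (del w)) hs.summable fun y => ?_
    have hadj : ‖(star T (del w)) y‖ = ‖(T (del y)) w‖ := by
      rw [← inner_del, ← inner_del, ContinuousLinearMap.star_eq_adjoint,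
        ContinuousLinearMap.adjoint_inner_right, norm_inner_symm]
    rw [hadj, one_apply_eq_self, norm_del, mul_one]
    exact hrow w y
  have hTT : ∀ x, ‖star T (T (del x))‖ ≤ K * (K * (japaneseBracket x)⁻¹ ^ 2) := fun x => by
    have hs := (hshift x).mul_right (K * (japaneseBracket x)⁻¹ ^ 2)
    rw [← hs.tsum_eq]
    refine norm_apply_le_tsum (star T) (T (del x)) hs.summable fun w => ?_
    have hz := zn_nonneg (x - w)
    have hz' := zn_nonneg (w - x)
    have hJx := japaneseBracket_pos x
    have hJw := japaneseBracket_pos w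
    calc ‖(T (del x)) w‖ * ‖star T (del w)‖
        ≤ C * zn (w - x) * Real.exp (-ν * zn (w - x)) * (japaneseBracket x)⁻¹
          * (K * ((1 + zn (x - w)) * (japaneseBracket x)⁻¹)) := by
          refine mul_le_mul (hcoord w x) ((hTstar w).trans ?_) (norm_nonneg _) (by positivity)
          exact mul_le_mul_of_nonneg_left (inv_japaneseBracket_le x w) hK
      _ = G (w - x) * (K * (japaneseBracket x)⁻¹ ^ 2) := by
          rw [zn_sub_comm x w]
          simp only [hG]
          ring
  refine (summable_inv_japaneseBracket_pow_three.mul_left (K ^ 3)).of_norm_bounded fun x => ?_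
  have hJ := japaneseBracket_pos x
  calc ‖(⟪del x, (S ^ 3) (del x)⟫).re‖
      ≤ ‖T (del x)‖ * ‖star T (T (del x))‖ := abs_re_inner_pow_three_le hS hST _
    _ ≤ K * (japaneseBracket x)⁻¹ * (K * (K * (japaneseBracket x)⁻¹ ^ 2)) :=
        mul_le_mul (hT x) (hTT x) (norm_nonneg _) (by positivity)
    _ = K ^ 3 * (japaneseBracket x)⁻¹ ^ 3 := by ring
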